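/- Let r ≥ 2. For any connected graph G with distance matrix D, every (0,1,...,r−1,*)-addressing of G has length at least max(n_+(D)/(r−1), n_−(D)/(r−1)). -/

import Mathlib

/-- A `(0,1,…,r-1,*)`-addressing of length `N`: the distance between two vertices is
the number of coordinates where both entries are non-`*` and differ. -/
def isAddressingR {V : Type*} (r : ℕ) (G : SimpleGraph V) (N : ℕ)
    (f : V → Fin N → Option (Fin r)) : Prop :=
  ∀ u v : V, G.dist u v =
    (Finset.univ.filter fun j : Fin N =>
      ∃ a b : Fin r, f u j = some a ∧ f v j = some b ∧ a ≠ b).card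

open Matrix in
/-- If a symmetric form is nonpositive (after multiplying by `σ`) on the kernel of a linear map into
`ι → ℝ`, then at most `card ι` eigenvalues are positive (after multiplying by `σ`). -/
theorem Matrix.IsHermitian.card_pos_eigenvalues_le {V ι : Type*} [Fintype V] [DecidableEq V]
    [Fintype ι] {D : Matrix V V ℝ} (hD : D.IsHermitian) (σ : ℝ) (L : (V → ℝ) →ₗ[ℝ] (ι → ℝ))
    (hL : ∀ x, L x = 0 → σ * (x ⬝ᵥ D *ᵥ x) ≤ 0) :
    (Finset.univ.filter fun v => 0 < σ * hD.eigenvalues v).card ≤ Fintype.card ι := by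
  classical
  by_contra! hlt
  set S := Finset.univ.filter fun v => 0 < σ * hD.eigenvalues v with hS
  let e : V → V → ℝ := fun v => hD.eigenvectorBasis v
  have he : ∀ v w, e v ⬝ᵥ e w = if v = w then 1 else 0 := by
    intro v w
    have h := orthonormal_iff_ite.mp hD.eigenvectorBasis.orthonormal v w
    rw [← h, EuclideanSpace.inner_eq_star_dotProduct, dotProduct_comm]
    rfl
  have hDe : ∀ v, D *ᵥ e v = hD.eigenvalues v • e v := fun v => hD.mulVec_eigenvectorBasis v
  let T : (S → ℝ) →ₗ[ℝ] (V → ℝ) := Fintype.linearCombination ℝ fun v : S => e v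
  have hT : ∀ c, T c = ∑ v : S, c v • e v := fun c => rfl
  obtain ⟨c, hc, hc0⟩ : ∃ c, (L ∘ₗ T) c = 0 ∧ c ≠ 0 := by
    have h := LinearMap.ker_ne_bot_of_finrank_lt (f := L ∘ₗ T) (by simpa using hlt)
    obtain ⟨c, hc, hc0⟩ := (Submodule.ne_bot_iff _).mp h
    exact ⟨c, hc, hc0⟩
  have hform : T c ⬝ᵥ D *ᵥ T c = ∑ v : S, hD.eigenvalues v * c v ^ 2 := by
    simp only [hT, mulVec_sum, mulVec_smul, hDe, sum_dotProduct, dotProduct_sum, smul_dotProduct,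
      dotProduct_smul, he, smul_eq_mul, mul_ite, mul_one, mul_zero, ← Subtype.ext_iff,
      Finset.sum_ite_eq', Finset.mem_univ, if_true]
    exact Finset.sum_congr rfl fun v _ => by ring
  have hle := hL (T c) hc
  rw [hform, Finset.mul_sum] at hle
  have hpos : ∀ v : S, 0 < σ * hD.eigenvalues v := fun v => (Finset.mem_filter.mp v.2).2
  obtain ⟨w, hw⟩ := Function.ne_iff.mp hc0
  refine hle.not_gt (Finset.sum_pos' (fun v _ => ?_) ⟨w, Finset.mem_univ _, ?_⟩)
  · rw [← mul_assoc]
    exact mul_nonneg (hpos v).le (sq_nonneg _)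
  · rw [← mul_assoc]
    exact mul_pos (hpos w) (sq_pos_of_ne_zero hw)

/-- The total weight of the vertices whose `j`-th coordinate is `a`. -/
def addressWeight {V : Type*} [Fintype V] {r N : ℕ} (f : V → Fin N → Option (Fin r))
    (j : Fin N) (a : Fin r) : (V → ℝ) →ₗ[ℝ] ℝ :=
  Fintype.linearCombination ℝ fun u => if f u j = some a then (1 : ℝ) else 0

theorem addressWeight_apply {V : Type*} [Fintype V] {r N : ℕ} (f : V → Fin N → Option (Fin r))
    (j : Fin N) (a : Fin r) (x : V → ℝ) :
    addressWeight f j a x = ∑ u, x u * if f u j = some a then (1 : ℝ) else 0 := rfl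

theorem isAddressingR.dist_eq_sum {V : Type*} {r N : ℕ} {G : SimpleGraph V}
    {f : V → Fin N → Option (Fin r)} (hf : isAddressingR r G N f) (u v : V) :
    (G.dist u v : ℝ) = ∑ j, ((∑ a, if f u j = some a then (1 : ℝ) else 0) *
      (∑ a, if f v j = some a then (1 : ℝ) else 0) -
      ∑ a, (if f u j = some a then (1 : ℝ) else 0) * if f v j = some a then (1 : ℝ) else 0) := by
  classical
  rw [hf u v, Finset.card_filter, Nat.cast_sum]
  refine Finset.sum_congr rfl fun j _ => ?_
  obtain hu | ⟨a, hu⟩ := (f u j).eq_none_or_eq_some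
  · simp [hu]
  obtain hv | ⟨b, hv⟩ := (f v j).eq_none_or_eq_some
  · simp [hv]
  by_cases hab : a = b
  · simp [hu, hv, hab]
  · simp [hu, hv, hab]

open Matrix in
theorem isAddressingR.dotProduct_mulVec {V : Type*} [Fintype V] {r N : ℕ} {G : SimpleGraph V}
    {f : V → Fin N → Option (Fin r)} (hf : isAddressingR r G N f) {D : Matrix V V ℝ}
    (hD : ∀ u v, D u v = G.dist u v) (x : V → ℝ) :
    x ⬝ᵥ D *ᵥ x = ∑ j, ((∑ a, addressWeight f j a x) ^ 2 - ∑ a, addressWeight f j a x ^ 2) := by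
  have hsum : ∀ j, ∑ a, addressWeight f j a x =
      ∑ u, x u * ∑ a, if f u j = some a then (1 : ℝ) else 0 := by
    intro j
    simp only [addressWeight_apply, Finset.mul_sum]
    exact Finset.sum_comm
  have hsq : ∀ j, ∑ a, addressWeight f j a x ^ 2 = ∑ u, ∑ v, x u * x v *
      ∑ a, (if f u j = some a then (1 : ℝ) else 0) * if f v j = some a then (1 : ℝ) else 0 := by
    intro j
    simp only [addressWeight_apply, sq, Finset.sum_mul_sum]
    rw [Finset.sum_comm]
    refine Finset.sum_congr rfl fun u _ => ?_
    rw [Finset.sum_comm]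
    exact Finset.sum_congr rfl fun v _ => by
      rw [Finset.mul_sum]
      exact Finset.sum_congr rfl fun a _ => by ring
  have hterm : ∀ j, (∑ a, addressWeight f j a x) ^ 2 - ∑ a, addressWeight f j a x ^ 2 =
      ∑ u, ∑ v, x u * x v * ((∑ a, if f u j = some a then (1 : ℝ) else 0) *
      (∑ a, if f v j = some a then (1 : ℝ) else 0) -
      ∑ a, (if f u j = some a then (1 : ℝ) else 0) * if f v j = some a then (1 : ℝ) else 0) := by
    intro j
    rw [hsum, hsq, sq, Finset.sum_mul_sum, ← Finset.sum_sub_distrib]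
    refine Finset.sum_congr rfl fun u _ => ?_
    rw [← Finset.sum_sub_distrib]
    exact Finset.sum_congr rfl fun v _ => by ring
  simp only [hterm, dotProduct, mulVec, hD, hf.dist_eq_sum]
  rw [Finset.sum_comm]
  refine Finset.sum_congr rfl fun u _ => ?_
  rw [Finset.sum_comm, Finset.mul_sum]
  refine Finset.sum_congr rfl fun v _ => ?_
  rw [← Finset.mul_sum]
  ring

/-- Any `(0,1,…,r-1,*)`-addressing of a connected graph has length at least
`max(n₊(D), n₋(D)) / (r-1)` where `D` is the distance matrix. -/
theorem addressingR_eigenvalue_bound {V : Type*} [Fintype V] [DecidableEq V]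
    (r : ℕ) (hr : 2 ≤ r) (G : SimpleGraph V) (hG : G.Connected)
    (D : Matrix V V ℝ) (hDdef : ∀ u v, D u v = G.dist u v)
    (hD : D.IsHermitian) (N : ℕ) (f : V → Fin N → Option (Fin r))
    (hf : isAddressingR r G N f) :
    (Finset.univ.filter fun v => 0 < hD.eigenvalues v).card ≤ N * (r - 1) ∧
    (Finset.univ.filter fun v => hD.eigenvalues v < 0).card ≤ N * (r - 1) := by
  obtain ⟨m, rfl⟩ : ∃ m, r = m + 2 := ⟨r - 2, by omega⟩
  constructor
  · have h := hD.card_pos_eigenvalues_le 1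
      (LinearMap.pi fun j : Fin N => ∑ a, addressWeight f j a) fun x hx => by
        have hx' : ∀ j, ∑ a, addressWeight f j a x = 0 := fun j => by
          simpa using congrFun hx j
        rw [one_mul, hf.dotProduct_mulVec hDdef]
        refine Finset.sum_nonpos fun j _ => ?_
        rw [hx' j]
        have := Finset.sum_nonneg fun a (_ : a ∈ Finset.univ) => sq_nonneg (addressWeight f j a x)
        linarith
    simp only [one_mul, Fintype.card_fin] at h
    exact h.trans (Nat.le_mul_of_pos_right N (by omega))
  · have h := hD.card_pos_eigenvalues_le (-1)
      (LinearMap.pi fun p : Fin N × Fin (m + 1) =>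
        addressWeight f p.1 p.2.succ - addressWeight f p.1 0) fun x hx => by
        have hx' : ∀ j a, addressWeight f j a x = addressWeight f j 0 x := fun j a => by
          refine Fin.cases rfl (fun i => ?_) a
          exact sub_eq_zero.mp (congrFun hx (j, i))
        rw [neg_one_mul, neg_nonpos, hf.dotProduct_mulVec hDdef]
        refine Finset.sum_nonneg fun j _ => ?_
        simp only [hx' j, Finset.sum_const, Finset.card_univ, Fintype.card_fin, nsmul_eq_mul]
        push_cast
        have : 0 ≤ ((m : ℝ) + 2) * (m + 1) * addressWeight f j 0 x ^ 2 := by positivity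
        linarith
    simpa using h
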